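/- arXiv:2102.06354 — 2 statements merged into one kernel-verified Lean document; each statement's English description precedes it below -/
import Mathlib

section
/- Let p, q be natural numbers with p ≥ 2 and q ≥ 2, let N < 0 be a real number, and let R > 0. Then the set {(x, y) ∈ ℝ^p × ℝ^q : ‖x‖² − ‖y‖² = N and ‖x‖² + ‖y‖² > R²} (where ‖·‖ denotes the Euclidean norm) is path-connected. -/
/-- For `p, q ≥ 2`, `N < 0` and `R > 0`, the part of the hyperboloid
`{(x,y) : ‖x‖² − ‖y‖² = N}` lying outside the Euclidean ball of radius `R`
in `ℝ^p × ℝ^q` is path-connected. -/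
theorem stmt_4 (p q : ℕ) (hp : 2 ≤ p) (hq : 2 ≤ q) (N : ℝ) (hN : N < 0)
    (R : ℝ) (hR : 0 < R) :
    IsPathConnected {z : EuclideanSpace ℝ (Fin p) × EuclideanSpace ℝ (Fin q) |
      ‖z.1‖ ^ 2 - ‖z.2‖ ^ 2 = N ∧ R ^ 2 < ‖z.1‖ ^ 2 + ‖z.2‖ ^ 2} := by
  have hS : ∀ n : ℕ, 2 ≤ n →
      IsPathConnected (Metric.sphere (0 : EuclideanSpace ℝ (Fin n)) 1) := by
    intro n hn
    apply isPathConnected_sphere _ _ zero_le_one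
    apply Module.one_lt_rank_of_one_lt_finrank
    rw [finrank_euclideanSpace_fin]
    omega
  have hI : IsPathConnected {r : ℝ | 0 ≤ r ∧ R ^ 2 < 2 * r ^ 2 - N} := by
    apply Convex.isPathConnected
    · apply Set.OrdConnected.convex
      constructor
      rintro a ⟨ha, ha'⟩ b - c ⟨hc, -⟩
      refine ⟨ha.trans hc, ?_⟩
      nlinarith
    · exact ⟨R, hR.le, by nlinarith⟩
  have hprod := ((hS p hp).prod (hS q hq)).prod hI
  have hc : Continuous (fun w : (EuclideanSpace ℝ (Fin p) × EuclideanSpace ℝ (Fin q)) × ℝ =>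
      (w.2 • w.1.1, Real.sqrt (w.2 ^ 2 - N) • w.1.2)) := by
    fun_prop
  convert hprod.image hc using 1
  ext ⟨x, y⟩
  simp only [Set.mem_setOf_eq, Set.mem_image, Prod.exists, Set.mem_prod, mem_sphere_zero_iff_norm,
    Prod.mk.injEq]
  constructor
  · rintro ⟨h1, h2⟩
    have hy : ‖y‖ ≠ 0 := by
      intro h
      rw [h] at h1
      nlinarith [sq_nonneg ‖x‖]
    have hs : Real.sqrt (‖x‖ ^ 2 - N) = ‖y‖ := by
      rw [show ‖x‖ ^ 2 - N = ‖y‖ ^ 2 by linarith, Real.sqrt_sq (norm_nonneg y)]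
    obtain ⟨u, hu, hux⟩ : ∃ u : EuclideanSpace ℝ (Fin p), ‖u‖ = 1 ∧ ‖x‖ • u = x := by
      by_cases hx : x = 0
      · obtain ⟨u, hu⟩ := (hS p hp).nonempty
        exact ⟨u, by simpa using hu, by simp [hx]⟩
      · have hx' : ‖x‖ ≠ 0 := norm_ne_zero_iff.mpr hx
        exact ⟨‖x‖⁻¹ • x, by simp [norm_smul, hx'], by simp [smul_smul, hx']⟩
    refine ⟨u, ‖y‖⁻¹ • y, ‖x‖, ⟨⟨hu, ?_⟩, norm_nonneg x, by linarith⟩, hux, ?_⟩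
    · rw [norm_smul, norm_inv, norm_norm, inv_mul_cancel₀ hy]
    · rw [hs, smul_smul, mul_inv_cancel₀ hy, one_smul]
  · rintro ⟨u, v, r, ⟨⟨hu, hv⟩, hr, hr'⟩, rfl, rfl⟩
    have h0 : 0 ≤ r ^ 2 - N := by nlinarith [sq_nonneg r]
    have e1 : ‖r • u‖ ^ 2 = r ^ 2 := by
      rw [norm_smul, hu, mul_one, Real.norm_eq_abs, sq_abs]
    have e2 : ‖Real.sqrt (r ^ 2 - N) • v‖ ^ 2 = r ^ 2 - N := by
      rw [norm_smul, hv, mul_one, Real.norm_eq_abs, sq_abs, Real.sq_sqrt h0]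
    rw [e1, e2]
    constructor <;> linarith
end

section
/- Let V be a real vector space with a symmetric bilinear form B, and let θ₁, θ₂, θ₃, δ ∈ V satisfy B(θ_i, θ_j) = δ_{ij} (Kronecker delta), B(θ_i, δ) = 0 for i = 1,2,3, and B(δ,δ) = −2. Let α ∈ V satisfy (B(α,θ₁), B(α,θ₂), B(α,θ₃)) ≠ (0,0,0). Then there exists ε₀ with 0 < ε₀ and ε₀² < 2 such that for all ε with 0 < ε < ε₀ and all (x₁,x₂,x₃) ∈ ℝ³ with x₁² + x₂² + x₃² = 1, setting ω_i = θ_i − (ε x_i/2) δ, μ = (ε²/2)/(1 − ε²/2), and ω*_j = ω_j + μ x_j (x₁ω₁ + x₂ω₂ + x₃ω₃), we have (B(α,ω*₁), B(α,ω*₂), B(α,ω*₃)) ≠ (0,0,0). -/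
/-- With `B(θᵢ,θⱼ) = δᵢⱼ`, `B(θᵢ,δ) = 0`, `B(δ,δ) = −2`, and `α ∈ V` with
`(B(α,θ₁), B(α,θ₂), B(α,θ₃)) ≠ 0`, there is `ε₀ > 0` with `ε₀² < 2` such that
for all `0 < ε < ε₀` and all unit vectors `x ∈ ℝ³`, setting
`ωᵢ = θᵢ − (ε xᵢ/2) δ`, `μ = (ε²/2)/(1 − ε²/2)` and
`ω*ⱼ = ωⱼ + μ xⱼ (x₁ω₁ + x₂ω₂ + x₃ω₃)`, the vector
`(B(α,ω*₁), B(α,ω*₂), B(α,ω*₃))` is nonzero. -/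
theorem stmt_11 {V : Type*} [AddCommGroup V] [Module ℝ V]
    (B : LinearMap.BilinForm ℝ V) (hsymm : B.IsSymm)
    (θ : Fin 3 → V) (δ : V)
    (hθθ : ∀ i j, B (θ i) (θ j) = if i = j then 1 else 0)
    (hθδ : ∀ i, B (θ i) δ = 0)
    (hδδ : B δ δ = -2)
    (α : V) (hα : ∃ i, B α (θ i) ≠ 0) :
    ∃ ε₀ : ℝ, 0 < ε₀ ∧ ε₀ ^ 2 < 2 ∧
      ∀ ε : ℝ, 0 < ε → ε < ε₀ →
        ∀ x : Fin 3 → ℝ, ∑ i, x i ^ 2 = 1 →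
          ∀ ω : Fin 3 → V, (∀ i, ω i = θ i - (ε * x i / 2) • δ) →
            ∀ μ : ℝ, μ = (ε ^ 2 / 2) / (1 - ε ^ 2 / 2) →
              ∀ ωs : Fin 3 → V, (∀ j, ωs j = ω j + (μ * x j) • (∑ k, x k • ω k)) →
                ∃ i, B α (ωs i) ≠ 0 := by
  obtain ⟨i, hi⟩ := hα
  have ha : 0 < |B α (θ i)| := abs_pos.mpr hi
  have hd : 0 ≤ |B α δ| := abs_nonneg _
  refine ⟨min 1 (|B α (θ i)| / (|B α δ| + 1)), by positivity, ?_, ?_⟩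
  · have h1 : min 1 (|B α (θ i)| / (|B α δ| + 1)) ≤ 1 := min_le_left _ _
    have h2 : 0 < min 1 (|B α (θ i)| / (|B α δ| + 1)) := by positivity
    nlinarith
  intro ε hε hε0 x hx ω hω μ hμ ωs hωs
  have hε1 : ε < 1 := lt_of_lt_of_le hε0 (min_le_left _ _)
  have hε2 : ε * (|B α δ| + 1) < |B α (θ i)| :=
    (lt_div_iff₀ (by positivity)).mp (lt_of_lt_of_le hε0 (min_le_right _ _))
  have hμ0 : 0 ≤ μ := by
    rw [hμ]
    apply div_nonneg (by positivity)
    nlinarith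
  by_contra! hcon
  have hw : ∀ j, B α (ω j) + μ * x j * (∑ k, x k * B α (ω k)) = 0 := by
    intro j
    have h := hcon j
    rw [hωs j] at h
    simpa only [map_add, map_smul, map_sum, smul_eq_mul] using h
  have hs : (1 + μ) * (∑ k, x k * B α (ω k)) = 0 := by
    have h0 := hw 0
    have h1 := hw 1
    have h2 := hw 2
    generalize hS : (∑ k, x k * B α (ω k)) = S at *
    simp only [Fin.sum_univ_three] at hS hx
    linear_combination x 0 * h0 + x 1 * h1 + x 2 * h2 - hS - μ * S * hx
  have hs0 : (∑ k, x k * B α (ω k)) = 0 := by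
    rcases mul_eq_zero.mp hs with h | h
    · linarith
    · exact h
  have hwi := hw i
  rw [hs0, hω i] at hwi
  simp only [map_sub, map_smul, smul_eq_mul, mul_zero, add_zero] at hwi
  have hxi : x i ^ 2 ≤ 1 := by
    rw [← hx]
    exact Finset.single_le_sum (f := fun i => x i ^ 2) (fun j _ => sq_nonneg _) (Finset.mem_univ i)
  have hxa : |x i| ≤ 1 := (sq_le_one_iff_abs_le_one _).mp hxi
  have he : |B α (θ i)| = ε / 2 * (|x i| * |B α δ|) := by
    have : B α (θ i) = ε / 2 * (x i * B α δ) := by linarith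
    rw [this, abs_mul, abs_mul, abs_of_pos (by positivity : 0 < ε / 2)]
  have h3 : |x i| * |B α δ| ≤ |B α δ| := mul_le_of_le_one_left hd hxa
  have h4 : ε / 2 * (|x i| * |B α δ|) ≤ ε / 2 * |B α δ| := by gcongr
  nlinarith [mul_nonneg hε.le hd]
end
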